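/- Forward-evaluation error recursion: let N ∈ ℕ, a > 1, c ≥ 0, and let γ: {0,1,…,N} → ℝ satisfy γ_N = 0 and γ_n ≤ a·γ_{n+1} + c·(a^{N−n} − 1)/(a − 1) for all 0 ≤ n < N. Then γ_n ≤ ( c/(a−1)² ) · ( (N−n)·a^{N−n+1} − (N−n+1)·a^{N−n} + 1 ) for all 0 ≤ n ≤ N. -/

import Mathlib

/-- Forward-evaluation error recursion (used in the proof of Theorem 2). -/
theorem forward_evaluation_error_recursion (N : ℕ) (a c : ℝ) (ha : 1 < a) (hc : 0 ≤ c)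
    (γ : ℕ → ℝ) (hγN : γ N = 0)
    (hrec : ∀ n, n < N → γ n ≤ a * γ (n + 1) + c * (a ^ (N - n) - 1) / (a - 1)) :
    ∀ n ≤ N, γ n ≤ c / (a - 1) ^ 2 *
      (((N - n : ℕ) : ℝ) * a ^ (N - n + 1) - (((N - n : ℕ) : ℝ) + 1) * a ^ (N - n) + 1) := by
  intro n hn
  induction hn using Nat.decreasingInduction with
  | self => simp [hγN]
  | of_succ k hk ih =>
    obtain ⟨m, rfl⟩ := Nat.exists_eq_add_of_lt hk
    have hsub : k + m + 1 - k = m + 1 := by omega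
    have hsub_succ : k + m + 1 - (k + 1) = m := by omega
    have hstep := hrec k hk
    rw [hsub] at hstep ⊢
    rw [hsub_succ] at ih
    have ha_ne : a - 1 ≠ 0 := by linarith
    have ha_nonneg : 0 ≤ a := by linarith
    refine (hstep.trans (add_le_add_left (mul_le_mul_of_nonneg_left ih ha_nonneg) _)).trans_eq ?_
    push_cast
    field_simp
    ring
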